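/- arXiv:2111.09584 — 6 statements merged into one kernel-verified Lean document; each statement's English description precedes it below -/
import Mathlib

section
/- A proper linear subspace W of ℝ^N is invariant under every element of the block upper-triangular unipotent group U_{𝓘₀} if and only if there exists j ∈ {0, 1, …, k₀−1} such that ℝ^{I_1 ∪ … ∪ I_j} ⊆ W ⊊ ℝ^{I_1 ∪ … ∪ I_{j+1}} (with the convention that the empty union gives the zero subspace). -/
open Matrix

variable {N k₀ : ℕ}

/-- The span of the standard basis vectors `e i` for indices `i` lying in the first `m`
blocks of the partition encoded by `c` (the block of `i` is `c i`, zero-indexed). -/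
def spanUpTo (c : Fin N → Fin k₀) (m : ℕ) : Submodule ℝ (Fin N → ℝ) :=
  Submodule.span ℝ {v | ∃ i : Fin N, (c i : ℕ) < m ∧ v = Pi.single i 1}

/-- The block upper-triangular unipotent group `U_{𝓘₀}`: elements of `SL_N(ℝ)` such that
`(1 - g)` maps each `ℝ^{I_k}` into `ℝ^{I_1 ∪ ⋯ ∪ I_{k-1}}`; equivalently, for all `i j`
with `c j ≤ c i` the entry `g i j` agrees with the identity matrix. -/
def Ugrp (c : Fin N → Fin k₀) : Set (Matrix.SpecialLinearGroup (Fin N) ℝ) :=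
  {g | ∀ i j : Fin N, c j ≤ c i → g.1 i j = (1 : Matrix (Fin N) (Fin N) ℝ) i j}

theorem mem_spanUpTo {c : Fin N → Fin k₀} {m : ℕ} {v : Fin N → ℝ} :
    v ∈ spanUpTo c m ↔ ∀ i, m ≤ (c i : ℕ) → v i = 0 := by
  constructor
  · intro hv i hi
    induction hv using Submodule.span_induction with
    | mem x hx =>
      obtain ⟨l, hl, rfl⟩ := hx
      have : i ≠ l := by rintro rfl; omega
      simp [this]
    | zero => rfl
    | add x y _ _ hx hy => simp [hx, hy]
    | smul a x _ hx => simp [hx]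
  · intro hv
    rw [pi_eq_sum_univ' v]
    refine Submodule.sum_mem _ fun i _ => ?_
    by_cases hi : (c i : ℕ) < m
    · refine Submodule.smul_mem _ _ (Submodule.subset_span ⟨i, hi, ?_⟩)
      ext l
      simp [Pi.single_apply, eq_comm]
    · simp [hv i (not_lt.mp hi)]

theorem spanUpTo_le_iff {c : Fin N → Fin k₀} {m : ℕ} {W : Submodule ℝ (Fin N → ℝ)} :
    spanUpTo c m ≤ W ↔ ∀ i, (c i : ℕ) < m → Pi.single i 1 ∈ W := by
  rw [spanUpTo, Submodule.span_le]
  constructor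
  · exact fun h i hi => h ⟨i, hi, rfl⟩
  · rintro h _ ⟨i, hi, rfl⟩
    exact h i hi

/-- An element of `Ugrp c` moves every vector of the `(j + 1)`-st step of the flag by a vector of
the `j`-th step. -/
theorem mulVec_sub_mem_spanUpTo {c : Fin N → Fin k₀} {g : Matrix.SpecialLinearGroup (Fin N) ℝ}
    (hg : g ∈ Ugrp c) {j : ℕ} {w : Fin N → ℝ} (hw : w ∈ spanUpTo c (j + 1)) :
    g.1.mulVec w - w ∈ spanUpTo c j := by
  rw [mem_spanUpTo] at hw ⊢
  intro i hi
  have h : g.1.mulVec w i = (1 : Matrix (Fin N) (Fin N) ℝ).mulVec w i := by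
    simp only [Matrix.mulVec, dotProduct]
    refine Finset.sum_congr rfl fun l _ => ?_
    by_cases hl : j + 1 ≤ (c l : ℕ)
    · simp [hw l hl]
    · rw [hg i l (Fin.le_def.mpr (by omega))]
  rw [Pi.sub_apply, h, Matrix.one_mulVec, sub_self]

/-- If `W` is invariant under `Ugrp c` and some vector of `W` has a nonzero `l`-th coordinate, then
`W` contains every basis vector from a block strictly before that of `l`. -/
theorem single_mem_of_invariant {c : Fin N → Fin k₀} {W : Submodule ℝ (Fin N → ℝ)}
    (hinv : ∀ g ∈ Ugrp c, ∀ w ∈ W, g.1.mulVec w ∈ W) {w : Fin N → ℝ} (hw : w ∈ W)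
    {i l : Fin N} (hl : w l ≠ 0) (hil : c i < c l) : Pi.single i 1 ∈ W := by
  have hne : i ≠ l := by rintro rfl; exact lt_irrefl _ hil
  have hmem := hinv ⟨Matrix.transvection i l 1, Matrix.det_transvection_of_ne i l hne 1⟩
    (fun a b hab => by
      have : ¬ (i = a ∧ l = b) := by
        rintro ⟨rfl, rfl⟩
        exact absurd hil (not_lt.mpr hab)
      simp [Matrix.transvection, this]) w hw
  have hsingle : Pi.single i (w l) ∈ W := by
    have := W.sub_mem hmem hw
    simpa [Matrix.transvection, Matrix.add_mulVec, Matrix.single_mulVec,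
      Function.update_eq_self, Pi.single] using this
  have := W.smul_mem (w l)⁻¹ hsingle
  rwa [← Pi.single_smul, smul_eq_mul, inv_mul_cancel₀ hl] at this

/-- a proper subspace `W ⊆ ℝ^N` is invariant under every element of
`U_{𝓘₀}` iff there is `j ∈ {0, …, k₀ - 1}` with
`ℝ^{I_1 ∪ ⋯ ∪ I_j} ⊆ W ⊊ ℝ^{I_1 ∪ ⋯ ∪ I_{j+1}}`. -/
theorem stmt0 (hN : 2 ≤ N) (c : Fin N → Fin k₀) (hmono : Monotone c)
    (hsurj : Function.Surjective c)
    (W : Submodule ℝ (Fin N → ℝ)) (hW : W ≠ ⊤) :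
    (∀ g ∈ Ugrp c, ∀ w ∈ W, g.1.mulVec w ∈ W) ↔
      ∃ j : ℕ, j < k₀ ∧ spanUpTo c j ≤ W ∧ W < spanUpTo c (j + 1) := by
  constructor
  · intro hinv
    have htop : ¬ spanUpTo c k₀ ≤ W := fun h =>
      hW (eq_top_iff.mpr fun v _ =>
        h (mem_spanUpTo.mpr fun i hi => absurd (c i).isLt (not_lt.mpr hi)))
    have hex : ∃ m, ¬ spanUpTo c m ≤ W := ⟨k₀, htop⟩
    classical
    obtain ⟨j, hj⟩ : ∃ j, Nat.find hex = j + 1 := by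
      refine Nat.exists_eq_succ_of_ne_zero fun h0 => Nat.find_spec hex ?_
      rw [h0, spanUpTo_le_iff]
      intro i hi
      omega
    have hspec : ¬ spanUpTo c (j + 1) ≤ W := hj ▸ Nat.find_spec hex
    refine ⟨j, ?_, not_not.mp (Nat.find_min hex (by omega)), lt_of_le_not_ge ?_ hspec⟩
    · have := Nat.find_min' hex htop
      omega
    · intro w hw
      rw [mem_spanUpTo]
      intro l hl
      by_contra hne
      exact hspec (spanUpTo_le_iff.mpr fun i hi =>
        single_mem_of_invariant hinv hw hne (Fin.lt_def.mpr (by omega)))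
  · rintro ⟨j, -, hle, hlt⟩ g hg w hw
    rw [← sub_add_cancel (g.1.mulVec w) w]
    exact W.add_mem (hle (mulVec_sub_mem_spanUpTo hg (hlt.le hw))) hw
end

section
/- A nonzero proper linear subspace W of ℝ^N is invariant under every element of K_{𝓘₀} and every element of U_{𝓘₀} if and only if there exists j ∈ {1, …, k₀−1} such that W = ℝ^{I_1 ∪ … ∪ I_j}. -/
open Matrix

variable {N k₀ : ℕ}

/-- The `k`-th diagonal block of a matrix `A`, as a matrix indexed by `{i // c i = k}`. -/
def blockOf (c : Fin N → Fin k₀) (A : Matrix (Fin N) (Fin N) ℝ) (k : Fin k₀) :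
    Matrix {i : Fin N // c i = k} {i : Fin N // c i = k} ℝ :=
  Matrix.of fun i j => A i.1 j.1

/-- The block-diagonal group `K_{𝓘₀} = SO(n_1) × ⋯ × SO(n_{k₀})`: block-diagonal matrices
each of whose diagonal blocks is special orthogonal. -/
def Kgrp (c : Fin N → Fin k₀) : Set (Matrix.SpecialLinearGroup (Fin N) ℝ) :=
  {g | (∀ i j : Fin N, c i ≠ c j → g.1 i j = 0) ∧
    ∀ k : Fin k₀, blockOf c g.1 k * (blockOf c g.1 k)ᵀ = 1 ∧ (blockOf c g.1 k).det = 1}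

/-- The quarter turn in the coordinate plane spanned by the `i`-th and `j`-th basis vectors. -/
def quarterTurn {n : Type*} [Fintype n] [DecidableEq n] (i j : n) : Matrix n n ℝ :=
  diagonal (fun a => if a = i then -1 else 1) * (Equiv.swap i j).permMatrix ℝ

section quarterTurn

variable {n : Type*} [Fintype n] [DecidableEq n]

lemma quarterTurn_apply (i j a b : n) :
    quarterTurn i j a b = if Equiv.swap i j a = b then (if a = i then -1 else 1) else 0 := by
  simp [quarterTurn, Equiv.Perm.permMatrix, PEquiv.toMatrix_apply, eq_comm]

lemma quarterTurn_mulVec (i j : n) (w : n → ℝ) (a : n) :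
    (quarterTurn i j *ᵥ w) a = (if a = i then -1 else 1) * w (Equiv.swap i j a) := by
  simp [mulVec, dotProduct, quarterTurn_apply]

lemma det_quarterTurn {i j : n} (hij : i ≠ j) : (quarterTurn i j).det = 1 := by
  simp [quarterTurn, det_permutation, Equiv.Perm.sign_swap hij, Finset.prod_ite_eq']

lemma quarterTurn_mul_transpose (i j : n) : quarterTurn i j * (quarterTurn i j)ᵀ = 1 := by
  ext a b
  have hsq : (if a = i then (-1 : ℝ) else 1) * (if a = i then -1 else 1) = 1 := by
    split_ifs <;> norm_num
  by_cases hab : a = b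
  · subst hab
    simpa [mul_apply, quarterTurn_apply] using hsq
  · simp [mul_apply, quarterTurn_apply, hab]

end quarterTurn

lemma blockOf_quarterTurn_self (c : Fin N → Fin k₀) {i j : Fin N} {k : Fin k₀}
    (hi : c i = k) (hj : c j = k) :
    blockOf c (quarterTurn i j) k = quarterTurn ⟨i, hi⟩ ⟨j, hj⟩ := by
  ext ⟨a, ha⟩ ⟨b, hb⟩
  simp only [blockOf, of_apply, quarterTurn_apply, Equiv.swap_apply_def, Subtype.mk.injEq]
  split_ifs <;> simp_all

lemma blockOf_quarterTurn_of_ne (c : Fin N → Fin k₀) {i j : Fin N} {k : Fin k₀}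
    (hi : c i ≠ k) (hj : c j ≠ k) : blockOf c (quarterTurn i j) k = 1 := by
  ext ⟨a, ha⟩ ⟨b, hb⟩
  have hai : a ≠ i := by rintro rfl; exact hi ha
  have haj : a ≠ j := by rintro rfl; exact hj ha
  simp [blockOf, quarterTurn_apply, Equiv.swap_apply_of_ne_of_ne hai haj, hai, one_apply]

lemma quarterTurn_mem_Kgrp (c : Fin N → Fin k₀) {i j : Fin N} (hij : i ≠ j) (hc : c i = c j) :
    (⟨quarterTurn i j, det_quarterTurn hij⟩ : SpecialLinearGroup (Fin N) ℝ) ∈ Kgrp c := by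
  refine ⟨fun a b hab => ?_, fun k => ?_⟩
  · change quarterTurn i j a b = 0
    rw [quarterTurn_apply, if_neg]
    rintro rfl
    rw [Equiv.swap_apply_def] at hab
    split_ifs at hab <;> simp_all
  · change blockOf c (quarterTurn i j) k * (blockOf c (quarterTurn i j) k)ᵀ = 1 ∧
      (blockOf c (quarterTurn i j) k).det = 1
    by_cases hk : c i = k
    · rw [blockOf_quarterTurn_self c hk (hc ▸ hk)]
      exact ⟨quarterTurn_mul_transpose _ _, det_quarterTurn (by simpa using hij)⟩
    · rw [blockOf_quarterTurn_of_ne c hk (hc ▸ hk)]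
      simp

lemma transvection_mem_Ugrp (c : Fin N → Fin k₀) {i j : Fin N} (hc : c i < c j) :
    (⟨transvection i j 1, det_transvection_of_ne i j (fun h => hc.ne (congrArg c h)) 1⟩ :
      SpecialLinearGroup (Fin N) ℝ) ∈ Ugrp c := by
  intro a b hab
  change transvection i j (1 : ℝ) a b = _
  rw [transvection, Matrix.add_apply, single_apply_of_ne, add_zero]
  rintro ⟨rfl, rfl⟩
  exact absurd hab (not_le.2 hc)

lemma mem_spanUpTo_iff (c : Fin N → Fin k₀) (m : ℕ) (v : Fin N → ℝ) :
    v ∈ spanUpTo c m ↔ ∀ i, m ≤ (c i : ℕ) → v i = 0 := by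
  constructor
  · intro hv i hi
    induction hv using Submodule.span_induction with
    | mem x hx =>
      obtain ⟨j, hj, rfl⟩ := hx
      exact Pi.single_eq_of_ne (by rintro rfl; omega) _
    | zero => rfl
    | add x y _ _ hx hy => simp [hx, hy]
    | smul a x _ hx => simp [hx]
  · intro hv
    rw [pi_eq_sum_univ' v]
    refine Submodule.sum_mem _ fun i _ => ?_
    by_cases hi : m ≤ (c i : ℕ)
    · simp [hv i hi]
    · refine Submodule.smul_mem _ _ (Submodule.subset_span ⟨i, not_le.1 hi, ?_⟩)
      ext a
      simp [Pi.single_apply, eq_comm]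

lemma mulVec_mem_spanUpTo (c : Fin N → Fin k₀) (m : ℕ) {A : Matrix (Fin N) (Fin N) ℝ}
    (hA : ∀ i j, c j < c i → A i j = 0) {v : Fin N → ℝ} (hv : v ∈ spanUpTo c m) :
    A *ᵥ v ∈ spanUpTo c m := by
  rw [mem_spanUpTo_iff] at hv ⊢
  intro i hi
  rw [mulVec, dotProduct]
  refine Finset.sum_eq_zero fun j _ => ?_
  by_cases hj : c j < c i
  · simp [hA i j hj]
  · simp [hv j (hi.trans (not_lt.1 hj))]

/-- A `U`-invariant subspace containing a vector with nonzero `j`-th coordinate contains all basis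
vectors of the blocks preceding that of `j`. -/
lemma single_mem_of_Ugrp_invariant {c : Fin N → Fin k₀} {W : Submodule ℝ (Fin N → ℝ)}
    (hU : ∀ g ∈ Ugrp c, ∀ w ∈ W, g.1.mulVec w ∈ W) {w : Fin N → ℝ} (hw : w ∈ W)
    {i j : Fin N} (hj : w j ≠ 0) (hc : c i < c j) : Pi.single i (1 : ℝ) ∈ W := by
  have h := W.sub_mem (hU _ (transvection_mem_Ugrp c hc) w hw) hw
  refine (W.smul_mem_iff hj).1 ?_
  convert h using 1
  ext a
  simp [transvection, add_mulVec, Pi.single_apply, single_mulVec, Function.update_apply]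

/-- A `K`-invariant subspace containing a vector with nonzero `j`-th coordinate contains all other
basis vectors of the block of `j`. -/
lemma single_mem_of_Kgrp_invariant {c : Fin N → Fin k₀} {W : Submodule ℝ (Fin N → ℝ)}
    (hK : ∀ g ∈ Kgrp c, ∀ w ∈ W, g.1.mulVec w ∈ W) {w : Fin N → ℝ} (hw : w ∈ W)
    {i j : Fin N} (hj : w j ≠ 0) (hij : i ≠ j) (hc : c i = c j) : Pi.single i (1 : ℝ) ∈ W := by
  have hR : ∀ v ∈ W, quarterTurn i j *ᵥ v ∈ W := hK _ (quarterTurn_mem_Kgrp c hij hc)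
  have hu := W.sub_mem hw (hR _ (hR w hw))
  have hv := W.sub_mem (W.smul_mem (w i) hu) (W.smul_mem (w j) (hR _ hu))
  have hpos : 2 * (w i ^ 2 + w j ^ 2) ≠ 0 := by positivity
  refine (W.smul_mem_iff hpos).1 ?_
  convert hv using 1
  ext a
  by_cases hai : a = i
  · subst hai
    simp [-mulVec_mulVec, quarterTurn_mulVec, hij.symm]
    ring
  by_cases haj : a = j
  · subst haj
    simp [-mulVec_mulVec, quarterTurn_mulVec, hij.symm]
    ring
  · simp [-mulVec_mulVec, quarterTurn_mulVec, hai, Equiv.swap_apply_of_ne_of_ne hai haj]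

/-- a nonzero proper subspace `W ⊆ ℝ^N` is invariant under every element of
`K_{𝓘₀}` and every element of `U_{𝓘₀}` iff `W = ℝ^{I_1 ∪ ⋯ ∪ I_j}` for some
`j ∈ {1, …, k₀ - 1}`. -/
theorem stmt1 (hN : 2 ≤ N) (c : Fin N → Fin k₀) (hmono : Monotone c)
    (hsurj : Function.Surjective c)
    (W : Submodule ℝ (Fin N → ℝ)) (hW0 : W ≠ ⊥) (hW : W ≠ ⊤) :
    ((∀ g ∈ Kgrp c, ∀ w ∈ W, g.1.mulVec w ∈ W) ∧
        (∀ g ∈ Ugrp c, ∀ w ∈ W, g.1.mulVec w ∈ W)) ↔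
      ∃ j : ℕ, 1 ≤ j ∧ j < k₀ ∧ W = spanUpTo c j := by
  constructor
  · rintro ⟨hK, hU⟩
    obtain ⟨w₀, hw₀, hne⟩ := W.ne_bot_iff.1 hW0
    obtain ⟨j₀, hj₀⟩ := Function.ne_iff.1 hne
    obtain ⟨j, ⟨w, hw, hj⟩, hmax⟩ := Set.exists_max_image {j | ∃ w ∈ W, w j ≠ 0} c
      (Set.toFinite _) ⟨j₀, w₀, hw₀, hj₀⟩
    have hzero : ∀ v ∈ W, ∀ i, c j < c i → v i = 0 := fun v hv i hi => by
      by_contra h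
      exact absurd (hmax i ⟨v, hv, h⟩) (not_le.2 hi)
    have hbasis : ∀ i ≠ j, c i ≤ c j → Pi.single i (1 : ℝ) ∈ W := fun i hij hi => by
      rcases hi.lt_or_eq with h | h
      · exact single_mem_of_Ugrp_invariant hU hw hj h
      · exact single_mem_of_Kgrp_invariant hK hw hj hij h
    have hjW : Pi.single j (1 : ℝ) ∈ W := by
      have hsum : ∑ i ∈ Finset.univ.erase j, w i • Pi.single i (1 : ℝ) ∈ W := by
        refine W.sum_mem fun i hi => ?_
        by_cases h : c j < c i
        · simp [hzero w hw i h]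
        · exact W.smul_mem _ (hbasis i (Finset.ne_of_mem_erase hi) (not_lt.1 h))
      have hdecomp : w j • Pi.single j (1 : ℝ) +
          ∑ i ∈ Finset.univ.erase j, w i • Pi.single i (1 : ℝ) = w := by
        rw [Finset.add_sum_erase _ (fun i => w i • Pi.single i (1 : ℝ)) (Finset.mem_univ j)]
        ext a
        simp [Finset.sum_apply, Pi.single_apply]
      refine (W.smul_mem_iff hj).1 ((W.add_mem_iff_left hsum).1 ?_)
      rwa [hdecomp]
    have hWeq : W = spanUpTo c (c j + 1) := by
      apply le_antisymm
      · intro v hv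
        rw [mem_spanUpTo_iff]
        exact fun i hi => hzero v hv i hi
      · refine Submodule.span_le.2 ?_
        rintro _ ⟨i, hi, rfl⟩
        by_cases hij : i = j
        · exact hij ▸ hjW
        · exact hbasis i hij (Nat.lt_succ_iff.1 hi)
    refine ⟨c j + 1, by omega, ?_, hWeq⟩
    by_contra hk
    refine hW (hWeq.trans (eq_top_iff.2 fun v _ => (mem_spanUpTo_iff c _ v).2 fun i hi => ?_))
    have := (c i).isLt
    omega
  · rintro ⟨m, -, -, rfl⟩
    refine ⟨fun g hg w hw => mulVec_mem_spanUpTo c m (fun i j h => hg.1 i j h.ne') hw,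
      fun g hg w hw => mulVec_mem_spanUpTo c m (fun i j h => ?_) hw⟩
    rw [hg i j h.le, one_apply_ne]
    rintro rfl
    exact lt_irrefl _ h
end

section
/- Let K = SO_N(ℝ) and let U_{𝓘₀}·K = {u·k : u ∈ U_{𝓘₀}, k ∈ K} ⊆ SL_N(ℝ). Then the set G_hor := {g ∈ SL_N(ℝ) : g·(U_{𝓘₀}·K) = U_{𝓘₀}·K (equality of subsets of SL_N(ℝ))} equals N_K(U_{𝓘₀})·U_{𝓘₀}, where N_K(U_{𝓘₀}) = {k ∈ K : k U_{𝓘₀} k⁻¹ = U_{𝓘₀}} is the normalizer of U_{𝓘₀} in K. -/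
open Matrix Pointwise

variable {N k₀ : ℕ}

/-- `K = SO_N(ℝ)`, viewed as a subset of `SL_N(ℝ)`. -/
def SOset (N : ℕ) : Set (Matrix.SpecialLinearGroup (Fin N) ℝ) :=
  {g | g.1 * g.1ᵀ = 1}

/-- The normalizer `N_K(U_{𝓘₀}) = {k ∈ K : k U_{𝓘₀} k⁻¹ = U_{𝓘₀}}` of `U_{𝓘₀}` in
`K = SO_N(ℝ)`. -/
def NKset (c : Fin N → Fin k₀) : Set (Matrix.SpecialLinearGroup (Fin N) ℝ) :=
  {g | g ∈ SOset N ∧ (fun u => g * u * g⁻¹) '' Ugrp c = Ugrp c}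

theorem val_mul (A B : SpecialLinearGroup (Fin N) ℝ) : (A * B).1 = A.1 * B.1 := rfl

theorem val_one : (1 : SpecialLinearGroup (Fin N) ℝ).1 = 1 := rfl

theorem mul_mem_Ugrp {c : Fin N → Fin k₀} {u v : SpecialLinearGroup (Fin N) ℝ}
    (hu : u ∈ Ugrp c) (hv : v ∈ Ugrp c) : u * v ∈ Ugrp c := by
  intro i j hij
  rw [val_mul, Matrix.mul_apply, Finset.sum_eq_single i]
  · rw [hu i i le_rfl, hv i j hij, Matrix.one_apply_eq, one_mul]
  · intro r _ hr
    rcases le_or_gt (c r) (c i) with h | h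
    · rw [hu i r h, Matrix.one_apply_ne hr.symm, zero_mul]
    · rw [hv r j (hij.trans h.le), Matrix.one_apply_ne, mul_zero]
      rintro rfl
      exact absurd h hij.not_gt
  · simp

theorem inv_mem_Ugrp {c : Fin N → Fin k₀} {u : SpecialLinearGroup (Fin N) ℝ}
    (hu : u ∈ Ugrp c) : u⁻¹ ∈ Ugrp c := by
  suffices H : ∀ m : Fin k₀, ∀ i j : Fin N, c i = m → c j ≤ c i →
      (u⁻¹).1 i j = (1 : Matrix (Fin N) (Fin N) ℝ) i j from fun i j h => H _ i j rfl h
  intro m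
  induction m using WellFoundedGT.induction with
  | ind m ih =>
    rintro i j rfl hij
    have hmul : u.1 * (u⁻¹).1 = 1 := by
      rw [← val_mul, mul_inv_cancel, val_one]
    rw [← hmul, Matrix.mul_apply, Finset.sum_eq_single i]
    · rw [hu i i le_rfl, Matrix.one_apply_eq, one_mul]
    · intro r _ hr
      rcases le_or_gt (c r) (c i) with h | h
      · rw [hu i r h, Matrix.one_apply_ne hr.symm, zero_mul]
      · rw [ih (c r) h r j rfl (hij.trans h.le), Matrix.one_apply_ne, mul_zero]
        rintro rfl
        exact absurd h hij.not_gt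
    · simp

/-- `Ugrp c` as a subgroup of `SL_N(ℝ)`. -/
def Usubgroup (c : Fin N → Fin k₀) : Subgroup (SpecialLinearGroup (Fin N) ℝ) where
  carrier := Ugrp c
  mul_mem' := mul_mem_Ugrp
  one_mem' := fun _ _ _ => rfl
  inv_mem' := inv_mem_Ugrp

theorem mem_SOset_iff {g : SpecialLinearGroup (Fin N) ℝ} :
    g ∈ SOset N ↔ (g⁻¹).1 = g.1ᵀ := by
  have hmul : (g⁻¹).1 * g.1 = 1 := by
    rw [← val_mul, inv_mul_cancel, val_one]
  constructor
  · intro (h : g.1 * g.1ᵀ = 1)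
    exact left_inv_eq_right_inv hmul h
  · intro h
    rw [h] at hmul
    exact mul_eq_one_comm.mp hmul

/-- `SO_N(ℝ)` as a subgroup of `SL_N(ℝ)`. -/
def SOsubgroup (N : ℕ) : Subgroup (SpecialLinearGroup (Fin N) ℝ) where
  carrier := SOset N
  mul_mem' := by
    intro a b ha hb
    rw [mem_SOset_iff] at *
    rw [_root_.mul_inv_rev, val_mul, ha, hb, val_mul,
      Matrix.transpose_mul]
  one_mem' := by simp [SOset]
  inv_mem' := by
    intro a ha
    rw [mem_SOset_iff] at *
    rw [inv_inv, ha, Matrix.transpose_transpose]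

/-- A row of `u * uᵀ`, `u ∈ Ugrp c`, that vanishes on all later blocks has diagonal entry `1`. -/
theorem mul_transpose_apply_self_of_Ugrp {c : Fin N → Fin k₀}
    {u : SpecialLinearGroup (Fin N) ℝ} (hu : u ∈ Ugrp c) {l : Fin N}
    (hl : ∀ q, c l < c q → (u.1 * u.1ᵀ) l q = 0) : (u.1 * u.1ᵀ) l l = 1 := by
  have hinv := inv_mem_Ugrp hu
  have hmul : u.1 * u.1ᵀ * ((u⁻¹).1)ᵀ = u.1 := by
    rw [Matrix.mul_assoc, ← Matrix.transpose_mul, ← val_mul, inv_mul_cancel,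
      val_one, Matrix.transpose_one, Matrix.mul_one]
  have hrow : ∀ q, u.1 l q = (1 : Matrix (Fin N) (Fin N) ℝ) l q := by
    intro q
    rcases le_or_gt (c q) (c l) with h | h
    · exact hu l q h
    · rw [Matrix.one_apply_ne (by rintro rfl; exact lt_irrefl _ h), ← hmul, Matrix.mul_apply]
      refine Finset.sum_eq_zero fun r _ => ?_
      rcases lt_or_ge (c l) (c r) with hr | hr
      · rw [hl r hr, zero_mul]
      · rw [Matrix.transpose_apply, hinv q r (hr.trans h.le), Matrix.one_apply_ne, mul_zero]
        rintro rfl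
        exact absurd h hr.not_gt
  simp [Matrix.mul_apply, hrow, Matrix.one_apply]

theorem conj_mem_Ugrp {c : Fin N → Fin k₀} {k u : SpecialLinearGroup (Fin N) ℝ}
    (hk : k ∈ SOset N) (hblock : ∀ i j, c i ≠ c j → k.1 i j = 0) (hu : u ∈ Ugrp c) :
    k * u * k⁻¹ ∈ Ugrp c := by
  intro i j hij
  have hsub : (k * u * k⁻¹).1 = k.1 * (u.1 - 1) * k.1ᵀ + 1 := by
    rw [Matrix.mul_sub, Matrix.sub_mul, Matrix.mul_one, show k.1 * k.1ᵀ = 1 from hk,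
      val_mul, val_mul, mem_SOset_iff.mp hk, sub_add_cancel]
  rw [hsub, Matrix.add_apply, add_eq_right, Matrix.mul_apply]
  refine Finset.sum_eq_zero fun b _ => ?_
  rw [Matrix.mul_apply, Matrix.transpose_apply]
  by_cases hb : c j = c b
  · rw [Finset.sum_eq_zero, zero_mul]
    intro a _
    by_cases ha : c i = c a
    · rw [Matrix.sub_apply, hu a b (by rw [← ha, ← hb]; exact hij), sub_self, mul_zero]
    · rw [hblock i a ha, zero_mul]
  · rw [hblock j b hb, mul_zero]

/-- The elements of `SL_N(ℝ)` that preserve `U_{𝓘₀}·K` by left multiplication. -/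
def horStabilizer (c : Fin N → Fin k₀) : Subgroup (SpecialLinearGroup (Fin N) ℝ) :=
  MulAction.stabilizer _ (Ugrp c * SOset N)

theorem exists_conj_mul_transpose_eq {c : Fin N → Fin k₀} {k u : SpecialLinearGroup (Fin N) ℝ}
    (hk : k ∈ horStabilizer c) (hu : u ∈ Ugrp c) :
    ∃ v ∈ Ugrp c, k.1 * (u.1 * u.1ᵀ) * k.1ᵀ = v.1 * v.1ᵀ := by
  have hmem : k • u ∈ Ugrp c * SOset N := by
    rw [← MulAction.mem_stabilizer_iff.mp hk]
    exact Set.smul_mem_smul_set ⟨u, hu, 1, (SOsubgroup N).one_mem, mul_one u⟩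
  obtain ⟨v, hv, w, hw, hvw⟩ := hmem
  have hmat : v.1 * w.1 = k.1 * u.1 := by
    simpa using congrArg Subtype.val hvw
  refine ⟨v, hv, ?_⟩
  calc k.1 * (u.1 * u.1ᵀ) * k.1ᵀ = (k.1 * u.1) * (k.1 * u.1)ᵀ := by
        simp only [Matrix.transpose_mul, Matrix.mul_assoc]
    _ = v.1 * (w.1 * w.1ᵀ) * v.1ᵀ := by
        rw [← hmat]; simp only [Matrix.transpose_mul, Matrix.mul_assoc]
    _ = v.1 * v.1ᵀ := by rw [show w.1 * w.1ᵀ = 1 from hw, Matrix.mul_one]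

theorem transvection_mul_transpose_conj_apply {k : Matrix (Fin N) (Fin N) ℝ} (hk : k * kᵀ = 1)
    (i l p q : Fin N) (t : ℝ) :
    (k * (transvection i l t * (transvection i l t)ᵀ) * kᵀ) p q =
      (1 : Matrix (Fin N) (Fin N) ℝ) p q + t * (k p i * k q l + k p l * k q i) +
        t ^ 2 * (k p i * k q i) := by
  have hcol : ∀ p r, (k * transvection i l t) p r = k p r + if l = r then t * k p i else 0 := by
    intro p r
    by_cases h : l = r
    · subst h; simp
    · rw [mul_transvection_apply_of_ne _ _ _ _ (Ne.symm h), if_neg h, add_zero]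
  have hone : ∑ r, k p r * k q r = (1 : Matrix (Fin N) (Fin N) ℝ) p q := by
    rw [← hk, Matrix.mul_apply]; rfl
  have hassoc : k * (transvection i l t * (transvection i l t)ᵀ) * kᵀ =
      (k * transvection i l t) * (k * transvection i l t)ᵀ := by
    simp only [Matrix.transpose_mul, Matrix.mul_assoc]
  rw [hassoc, Matrix.mul_apply, ← hone]
  simp only [Matrix.transpose_apply, hcol, add_mul, mul_add, Finset.sum_add_distrib, ite_mul,
    mul_ite, mul_zero, zero_mul, Finset.sum_ite_eq, Finset.mem_univ, if_true]
  ring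

theorem apply_eq_zero_of_mem_horStabilizer {c : Fin N → Fin k₀} :
    ∀ (m : Fin k₀) (k : SpecialLinearGroup (Fin N) ℝ), k ∈ horStabilizer c → k ∈ SOset N →
      ∀ l i, c l = m → c l ≠ c i → k.1 l i = 0 := by
  intro m
  induction m using WellFoundedGT.induction with
  | ind m ih =>
    rintro k hk hkO l i rfl hli
    rcases hli.lt_or_gt with h | h
    · have := ih (c i) h k⁻¹ (inv_mem hk) ((SOsubgroup N).inv_mem hkO) i l rfl hli.symm
      rwa [mem_SOset_iff.mp hkO] at this
    · have hil : i ≠ l := by rintro rfl; exact hli rfl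
      have key : ∀ t : ℝ, t * (k.1 l i * k.1 l l + k.1 l l * k.1 l i) +
          t ^ 2 * (k.1 l i * k.1 l i) = 0 := by
        intro t
        let u : SpecialLinearGroup (Fin N) ℝ :=
          ⟨transvection i l t, det_transvection_of_ne i l hil t⟩
        have hu : u ∈ Ugrp c := by
          intro p q hpq
          have hne : ¬(i = p ∧ l = q) := by
            rintro ⟨rfl, rfl⟩
            exact absurd h hpq.not_gt
          simp [u, transvection, hne]
        obtain ⟨v, hv, huv⟩ := exists_conj_mul_transpose_eq hk hu
        have hentry := fun p q => transvection_mul_transpose_conj_apply hkO i l p q t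
        change k.1 * (transvection i l t * (transvection i l t)ᵀ) * k.1ᵀ = _ at huv
        have hdiag := mul_transpose_apply_self_of_Ugrp hv (l := l) fun q hq => by
          rw [← huv, hentry, ih (c q) hq k hk hkO q l rfl hq.ne',
            ih (c q) hq k hk hkO q i rfl (h.trans hq).ne',
            Matrix.one_apply_ne (by rintro rfl; exact lt_irrefl _ hq)]
          ring
        rw [← huv, hentry, Matrix.one_apply_eq] at hdiag
        linarith
      have h1 := key 1
      have h2 := key (-1)
      exact mul_self_eq_zero.mp (by linarith)

theorem mem_NKset_of_mem_horStabilizer {c : Fin N → Fin k₀} {k : SpecialLinearGroup (Fin N) ℝ}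
    (hk : k ∈ horStabilizer c) (hkO : k ∈ SOset N) : k ∈ NKset c := by
  have hblock : ∀ k ∈ horStabilizer c, k ∈ SOset N → ∀ i j, c i ≠ c j → k.1 i j = 0 :=
    fun k hk hkO i j => apply_eq_zero_of_mem_horStabilizer _ k hk hkO i j rfl
  refine ⟨hkO, Set.Subset.antisymm ?_ fun u hu => ?_⟩
  · rintro _ ⟨u, hu, rfl⟩
    exact conj_mem_Ugrp hkO (hblock k hk hkO) hu
  · have hkO' := (SOsubgroup N).inv_mem hkO
    exact ⟨k⁻¹ * u * k⁻¹⁻¹, conj_mem_Ugrp hkO' (hblock _ (inv_mem hk) hkO') hu, by group⟩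

theorem Ugrp_subset_horStabilizer (c : Fin N → Fin k₀) :
    Ugrp c ⊆ (horStabilizer c : Set (SpecialLinearGroup (Fin N) ℝ)) := by
  intro u hu
  have hset : u • Ugrp c = Ugrp c := smul_coe_set (s := Usubgroup c) hu
  change u • (Ugrp c * SOset N) = _
  rw [← smul_mul_assoc, hset]

theorem NKset_subset_horStabilizer (c : Fin N → Fin k₀) :
    NKset c ⊆ (horStabilizer c : Set (SpecialLinearGroup (Fin N) ℝ)) := by
  rintro k ⟨hkO, hkU⟩
  have hsub : ∀ x ∈ Ugrp c * SOset N, k * x ∈ Ugrp c * SOset N := by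
    rintro _ ⟨u, hu, w, hw, rfl⟩
    refine ⟨k * u * k⁻¹, hkU ▸ Set.mem_image_of_mem _ hu, k * w,
      (SOsubgroup N).mul_mem hkO hw, ?_⟩
    simp only [mul_assoc, inv_mul_cancel_left]
  refine Set.Subset.antisymm ?_ ?_
  · rintro _ ⟨x, hx, rfl⟩
    exact hsub x hx
  · rintro _ ⟨u, hu, w, hw, rfl⟩
    obtain ⟨v, hv, rfl⟩ := hkU.symm ▸ hu
    refine ⟨v * (k⁻¹ * w), ⟨v, hv, k⁻¹ * w,
      (SOsubgroup N).mul_mem ((SOsubgroup N).inv_mem hkO) hw, rfl⟩, ?_⟩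
    simp only [smul_eq_mul, mul_assoc]

/-- the stabilizer `G_hor = {g ∈ SL_N(ℝ) : g·(U_{𝓘₀}·K) = U_{𝓘₀}·K}` equals
`N_K(U_{𝓘₀})·U_{𝓘₀}`.  Here products of sets are pointwise products. -/
theorem stmt2 (hN : 2 ≤ N) (c : Fin N → Fin k₀) (hmono : Monotone c)
    (hsurj : Function.Surjective c) :
    {g : Matrix.SpecialLinearGroup (Fin N) ℝ |
        (fun x => g * x) '' (Ugrp c * SOset N) = Ugrp c * SOset N} =
      NKset c * Ugrp c := by
  change (horStabilizer c : Set (SpecialLinearGroup (Fin N) ℝ)) = _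
  refine Set.Subset.antisymm (fun g hg => ?_) ?_
  · have hmem : g • (1 : SpecialLinearGroup (Fin N) ℝ) ∈ Ugrp c * SOset N := by
      rw [← MulAction.mem_stabilizer_iff.mp hg]
      exact Set.smul_mem_smul_set
        ⟨1, (Usubgroup c).one_mem, 1, (SOsubgroup N).one_mem, mul_one 1⟩
    obtain ⟨u, hu, k, hk, huk⟩ := hmem
    have hg' : g = u * k := by simpa using huk.symm
    have hkS : k ∈ horStabilizer c := by
      rw [show k = u⁻¹ * g by rw [hg', inv_mul_cancel_left]]
      exact mul_mem (inv_mem (Ugrp_subset_horStabilizer c hu)) hg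
    have hkN := mem_NKset_of_mem_horStabilizer hkS hk
    obtain ⟨v, hv, hvu⟩ := hkN.2.symm ▸ hu
    refine ⟨k, hkN, v, hv, ?_⟩
    rw [hg', ← hvu]
    simp
  · rintro _ ⟨k, hk, u, hu, rfl⟩
    exact mul_mem (NKset_subset_horStabilizer c hk) (Ugrp_subset_horStabilizer c hu)
end

section
/- The normalizer of U_{𝓘₀} in SO_N(ℝ), namely {k ∈ SO_N(ℝ) : k U_{𝓘₀} k⁻¹ = U_{𝓘₀}}, equals the group of all block-diagonal matrices diag(M_1, …, M_{k₀}) with M_k ∈ O(n_k) for each k and det(M_1)·…·det(M_{k₀}) = 1. -/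
open Matrix Pointwise

variable {N k₀ : ℕ}

/-- Conjugation by a block-diagonal matrix preserves the unipotent block condition. -/
theorem conj_apply_of_blockDiagonal {c : Fin N → Fin k₀} {A B u : Matrix (Fin N) (Fin N) ℝ}
    (hAB : A * B = 1) (hA : ∀ i j, c i ≠ c j → A i j = 0) (hB : ∀ i j, c i ≠ c j → B i j = 0)
    (hu : ∀ i j, c j ≤ c i → u i j = (1 : Matrix (Fin N) (Fin N) ℝ) i j)
    {i j : Fin N} (hij : c j ≤ c i) :
    (A * u * B) i j = (1 : Matrix (Fin N) (Fin N) ℝ) i j := by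
  have h : A * u * B = 1 + A * (u - 1) * B := by
    rw [mul_sub, sub_mul, mul_one, hAB]; abel
  suffices h0 : (A * (u - 1) * B) i j = 0 by rw [h, Matrix.add_apply, h0, add_zero]
  rw [Matrix.mul_apply]
  refine Finset.sum_eq_zero fun b _ => ?_
  by_cases hb : c b = c j
  · rw [Matrix.mul_apply, Finset.sum_eq_zero, zero_mul]
    intro a _
    by_cases ha : c i = c a
    · rw [Matrix.sub_apply, hu a b (by rw [hb, ← ha]; exact hij), sub_self, mul_zero]
    · rw [hA i a ha, zero_mul]
  · rw [hB b j hb, mul_zero]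

theorem coe_inv_of_mem_SOset {g : Matrix.SpecialLinearGroup (Fin N) ℝ} (hg : g ∈ SOset N) :
    (g⁻¹).1 = g.1ᵀ := by
  have h : g.1 * (g⁻¹).1 = 1 := congrArg Subtype.val (mul_inv_cancel g)
  have h' : (g⁻¹).1 * g.1 = 1 := congrArg Subtype.val (inv_mul_cancel g)
  have hg' : g.1 * g.1ᵀ = 1 := hg
  calc (g⁻¹).1 = (g⁻¹).1 * (g.1 * g.1ᵀ) := by rw [hg', mul_one]
    _ = g.1ᵀ := by rw [← mul_assoc, h', one_mul]

/-- The Gram matrix of a block-diagonal matrix is computed block by block. -/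
theorem blockOf_mul_transpose {c : Fin N → Fin k₀} {A : Matrix (Fin N) (Fin N) ℝ}
    (hA : ∀ i j, c i ≠ c j → A i j = 0) (k : Fin k₀) :
    blockOf c A k * (blockOf c A k)ᵀ = blockOf c (A * Aᵀ) k := by
  ext ⟨i, hi⟩ ⟨j, hj⟩
  simp only [blockOf, Matrix.mul_apply, Matrix.transpose_apply, Matrix.of_apply]
  rw [← Finset.sum_subtype (Finset.univ.filter fun x => c x = k) (by simp)
    fun x => A i x * A j x]
  refine Finset.sum_subset (Finset.filter_subset _ _) fun x _ hx => ?_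
  have hx' : c x ≠ k := by simpa using hx
  rw [hA i x (hi ▸ hx'.symm), zero_mul]

theorem blockOf_one (c : Fin N → Fin k₀) (k : Fin k₀) :
    blockOf c (1 : Matrix (Fin N) (Fin N) ℝ) k = 1 := by
  ext i j
  simp [blockOf, Matrix.one_apply, Subtype.ext_iff]

theorem det_eq_prod_det_blockOf {c : Fin N → Fin k₀} {A : Matrix (Fin N) (Fin N) ℝ}
    (hA : ∀ i j, c i ≠ c j → A i j = 0) : A.det = ∏ k : Fin k₀, (blockOf c A k).det := by
  have h : A.BlockTriangular c := fun i j hij => hA i j hij.ne'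
  exact h.det_fintype

/-- Elements of `Ugrp c` stay in `Ugrp c` after conjugation by `g`; tested on transvections this
says that columns of `g` in different blocks have supports in increasing blocks. -/
theorem lt_of_normalizes {c : Fin N → Fin k₀} {g : Matrix.SpecialLinearGroup (Fin N) ℝ}
    (hg : g ∈ SOset N) (hU : ∀ u ∈ Ugrp c, g * u * g⁻¹ ∈ Ugrp c) {a b i j : Fin N}
    (hab : c a < c b) (hi : g.1 i a ≠ 0) (hj : g.1 j b ≠ 0) : c i < c j := by
  by_contra! hij
  have hne : a ≠ b := fun h => hab.ne (congrArg c h)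
  have hu : (⟨Matrix.transvection a b 1, Matrix.det_transvection_of_ne a b hne 1⟩ :
      Matrix.SpecialLinearGroup (Fin N) ℝ) ∈ Ugrp c := by
    intro x y hxy
    have : ¬ (a = x ∧ b = y) := by
      rintro ⟨rfl, rfl⟩
      exact absurd hab (not_lt.mpr hxy)
    simp [Matrix.transvection, this]
  have h : (g.1 * Matrix.transvection a b 1 * (g⁻¹).1 : Matrix (Fin N) (Fin N) ℝ) i j =
      (1 : Matrix (Fin N) (Fin N) ℝ) i j := hU _ hu i j hij
  have hg' : g.1 * g.1ᵀ = 1 := hg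
  rw [coe_inv_of_mem_SOset hg, Matrix.transvection, mul_add, add_mul, mul_one, hg',
    Matrix.add_apply, add_eq_left, Matrix.mul_apply, Finset.sum_eq_single b] at h
  · simp [hi, hj] at h
  · intro x _ hx
    rw [Matrix.mul_single_apply_of_ne (hbj := hx), zero_mul]
  · simp

theorem blockDiagonal_of_normalizes {c : Fin N → Fin k₀} (hsurj : Function.Surjective c)
    {g : Matrix.SpecialLinearGroup (Fin N) ℝ}
    (hg : g ∈ SOset N) (hU : ∀ u ∈ Ugrp c, g * u * g⁻¹ ∈ Ugrp c) {i j : Fin N}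
    (hij : c i ≠ c j) : g.1 i j = 0 := by
  by_contra h0
  have hcol : ∀ a, ∃ x, g.1 x a ≠ 0 := by
    intro a
    by_contra! h
    exact one_ne_zero (g.2.symm.trans (Matrix.det_eq_zero_of_column_eq_zero a h))
  have hex : ∀ k, ∃ a x, c a = k ∧ g.1 x a ≠ 0 ∧ (k = c j → x = i) := by
    intro k
    by_cases hk : k = c j
    · exact ⟨j, i, hk.symm, h0, fun _ => rfl⟩
    · obtain ⟨a, ha⟩ := hsurj k
      obtain ⟨x, hx⟩ := hcol a
      exact ⟨a, x, ha, hx, fun h => absurd h hk⟩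
  choose a x ha hx hxi using hex
  have hmono : StrictMono fun k => c (x k) := fun k l hkl =>
    lt_of_normalizes hg hU (by rwa [ha, ha]) (hx k) (hx l)
  have hid := le_antisymm (hmono.le_id (c j)) (hmono.id_le (c j))
  rw [hxi _ rfl] at hid
  exact hij hid

theorem mem_SOset_of_blockDiagonal {c : Fin N → Fin k₀}
    {g : Matrix.SpecialLinearGroup (Fin N) ℝ} (hd : ∀ i j, c i ≠ c j → g.1 i j = 0)
    (ho : ∀ k, blockOf c g.1 k * (blockOf c g.1 k)ᵀ = 1) : g ∈ SOset N := by
  change g.1 * g.1ᵀ = 1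
  ext i j
  by_cases hij : c i = c j
  · have h := ho (c j)
    rw [blockOf_mul_transpose hd, ← blockOf_one] at h
    exact congrFun (congrFun h ⟨i, hij⟩) ⟨j, rfl⟩
  · rw [Matrix.one_apply_ne fun h => hij (congrArg c h), Matrix.mul_apply]
    refine Finset.sum_eq_zero fun x _ => ?_
    by_cases hx : c i = c x
    · rw [Matrix.transpose_apply, hd j x fun h => hij (hx.trans h.symm), mul_zero]
    · rw [hd i x hx, zero_mul]

/-- the normalizer of `U_{𝓘₀}` in `SO_N(ℝ)` equals the group
`S(O(n_1) × ⋯ × O(n_{k₀}))` of block-diagonal matrices whose blocks are orthogonal and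
whose block determinants have product `1`. -/
theorem stmt3 (hN : 2 ≤ N) (c : Fin N → Fin k₀) (hmono : Monotone c)
    (hsurj : Function.Surjective c) :
    NKset c =
      {g : Matrix.SpecialLinearGroup (Fin N) ℝ |
        (∀ i j : Fin N, c i ≠ c j → g.1 i j = 0) ∧
        (∀ k : Fin k₀, blockOf c g.1 k * (blockOf c g.1 k)ᵀ = 1) ∧
        ∏ k : Fin k₀, (blockOf c g.1 k).det = 1} := by
  ext g
  constructor
  · rintro ⟨hg, hU⟩
    have hd : ∀ i j, c i ≠ c j → g.1 i j = 0 := fun i j hij =>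
      blockDiagonal_of_normalizes hsurj hg
        (fun u hu => hU ▸ Set.mem_image_of_mem (fun u => g * u * g⁻¹) hu) hij
    refine ⟨hd, fun k => ?_, (det_eq_prod_det_blockOf hd).symm.trans g.2⟩
    rw [blockOf_mul_transpose hd, show g.1 * g.1ᵀ = 1 from hg, blockOf_one]
  · rintro ⟨hd, ho, -⟩
    have hg := mem_SOset_of_blockDiagonal hd ho
    have hd' : ∀ i j, c i ≠ c j → (g⁻¹).1 i j = 0 := fun i j hij => by
      rw [coe_inv_of_mem_SOset hg]
      exact hd j i hij.symm
    refine ⟨hg, Set.Subset.antisymm ?_ fun w hw => ?_⟩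
    · rintro _ ⟨u, hu, rfl⟩ i j hij
      exact conj_apply_of_blockDiagonal (congrArg Subtype.val (mul_inv_cancel g)) hd hd' hu hij
    · refine ⟨g⁻¹ * w * g, fun i j hij => ?_, by group⟩
      exact conj_apply_of_blockDiagonal (congrArg Subtype.val (inv_mul_cancel g)) hd' hd hw hij
end

section
/- If γ ∈ SL_N(ℤ) can be written as γ = k·u with k ∈ K_{𝓘₀} and u ∈ U_{𝓘₀}, then both k and u have integer entries; that is, (K_{𝓘₀}·U_{𝓘₀}) ∩ SL_N(ℤ) = (K_{𝓘₀} ∩ SL_N(ℤ))·(U_{𝓘₀} ∩ SL_N(ℤ)). -/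
open Matrix Pointwise

variable {N k₀ : ℕ}

/-- The set of elements of `SL_N(ℝ)` all of whose entries are integers, i.e. `SL_N(ℤ)`. -/
def SLZset (N : ℕ) : Set (Matrix.SpecialLinearGroup (Fin N) ℝ) :=
  {g | ∀ i j : Fin N, ∃ m : ℤ, g.1 i j = (m : ℝ)}

/-- `SLZset N` is the underlying set of the image of `SL_N(ℤ)` in `SL_N(ℝ)`. -/
theorem mem_SLZset_iff {N : ℕ} (g : Matrix.SpecialLinearGroup (Fin N) ℝ) :
    g ∈ SLZset N ↔
      g ∈ (Matrix.SpecialLinearGroup.map (n := Fin N) (Int.castRingHom ℝ)).range := by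
  constructor
  · intro hg
    choose m hm using hg
    have hmap : (Int.castRingHom ℝ).mapMatrix (Matrix.of m) = g.1 := by
      ext i j
      simp [hm]
    have hdet : (Matrix.of m).det = 1 := by
      have h := (Int.castRingHom ℝ).map_det (Matrix.of m)
      rw [hmap, g.2, eq_intCast] at h
      exact_mod_cast h
    exact ⟨⟨Matrix.of m, hdet⟩, Subtype.ext hmap⟩
  · rintro ⟨a, rfl⟩ i j
    exact ⟨a.1 i j, rfl⟩

/-- Within a diagonal block, multiplying a block-diagonal matrix by a block-unipotent one does not
change the entries. -/
theorem mul_apply_of_mem_Kgrp_of_mem_Ugrp {N k₀ : ℕ} {c : Fin N → Fin k₀}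
    {k u : Matrix.SpecialLinearGroup (Fin N) ℝ} (hk : k ∈ Kgrp c) (hu : u ∈ Ugrp c)
    {i j : Fin N} (hij : c i = c j) : (k * u).1 i j = k.1 i j := by
  change (k.1 * u.1) i j = k.1 i j
  have h : (k.1 * u.1) i j = (k.1 * (1 : Matrix (Fin N) (Fin N) ℝ)) i j := by
    simp only [Matrix.mul_apply]
    refine Finset.sum_congr rfl fun l _ => ?_
    by_cases hl : c i = c l
    · rw [hu l j (hij.symm.trans hl).le]
    · rw [hk.1 i l hl, zero_mul, zero_mul]
  rw [h, Matrix.mul_one]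

theorem mem_SLZset_of_mul_mem {N k₀ : ℕ} {c : Fin N → Fin k₀}
    {k u : Matrix.SpecialLinearGroup (Fin N) ℝ} (hk : k ∈ Kgrp c) (hu : u ∈ Ugrp c)
    (hku : k * u ∈ SLZset N) : k ∈ SLZset N ∧ u ∈ SLZset N := by
  have hkZ : k ∈ SLZset N := fun i j => by
    by_cases hij : c i = c j
    · obtain ⟨m, hm⟩ := hku i j
      exact ⟨m, by rw [← hm, mul_apply_of_mem_Kgrp_of_mem_Ugrp hk hu hij]⟩
    · exact ⟨0, by rw [hk.1 i j hij, Int.cast_zero]⟩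
  refine ⟨hkZ, ?_⟩
  rw [mem_SLZset_iff] at hkZ hku ⊢
  exact (Subgroup.mul_mem_cancel_left _ hkZ).1 hku

/-- if `γ ∈ SL_N(ℤ)` is written as `γ = k·u` with `k ∈ K_{𝓘₀}` and
`u ∈ U_{𝓘₀}`, then both `k` and `u` have integer entries; that is,
`(K_{𝓘₀}·U_{𝓘₀}) ∩ SL_N(ℤ) = (K_{𝓘₀} ∩ SL_N(ℤ))·(U_{𝓘₀} ∩ SL_N(ℤ))`. -/
theorem stmt6 (hN : 2 ≤ N) (c : Fin N → Fin k₀) (hmono : Monotone c)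
    (hsurj : Function.Surjective c) :
    (∀ γ k u : Matrix.SpecialLinearGroup (Fin N) ℝ,
        γ ∈ SLZset N → k ∈ Kgrp c → u ∈ Ugrp c → γ = k * u →
        k ∈ SLZset N ∧ u ∈ SLZset N) ∧
      (Kgrp c * Ugrp c) ∩ SLZset N = (Kgrp c ∩ SLZset N) * (Ugrp c ∩ SLZset N) := by
  refine ⟨fun γ k u hγ hk hu h => mem_SLZset_of_mul_mem hk hu (h ▸ hγ), Set.Subset.antisymm ?_ ?_⟩
  · rintro _ ⟨⟨k, hk, u, hu, rfl⟩, hku⟩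
    obtain ⟨hkZ, huZ⟩ := mem_SLZset_of_mul_mem hk hu hku
    exact Set.mul_mem_mul ⟨hk, hkZ⟩ ⟨hu, huZ⟩
  · rintro _ ⟨k, ⟨hk, hkZ⟩, u, ⟨hu, huZ⟩, rfl⟩
    refine ⟨Set.mul_mem_mul hk hu, ?_⟩
    rw [mem_SLZset_iff] at hkZ huZ ⊢
    exact mul_mem hkZ huZ
end

section
/- Let S ⊆ sl_N(ℝ) be the subspace S = so_N + 𝔩, where so_N is the space of antisymmetric N × N real matrices and 𝔩 is the space of traceless block-diagonal matrices (with diagonal blocks of sizes n_1, …, n_{k₀}), and let 𝔲 be the space of strictly block upper-triangular matrices, i.e. X with X·ℝ^{I_k} ⊆ ℝ^{I_1 ∪ … ∪ I_{k−1}} for all k. Then: (i) sl_N(ℝ) = S ⊕ 𝔲 as vector spaces; and (ii) with respect to the Frobenius inner product ⟨X, Y⟩ = Tr(X Yᵀ), for any orthonormal basis B of S and any orthonormal basis B′ of 𝔲, the determinant of the family B ∪ B′ computed in any orthonormal basis of sl_N(ℝ) has absolute value 2^{−d/2}, where d = Σ_{1 ≤ s < t ≤ k₀} n_s n_t = dim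 𝔲. -/
open Matrix

variable {N k₀ : ℕ}

/-- The traceless matrices `sl_N(ℝ)`, as a submodule of the `N × N` real matrices. -/
def slSub (N : ℕ) : Submodule ℝ (Matrix (Fin N) (Fin N) ℝ) :=
  LinearMap.ker (Matrix.traceLinearMap (Fin N) ℝ ℝ)

/-- The antisymmetric matrices `so_N`. -/
def soSub (N : ℕ) : Submodule ℝ (Matrix (Fin N) (Fin N) ℝ) where
  carrier := {X | Xᵀ = -X}
  add_mem' := by
    intro X Y hX hY
    simp only [Set.mem_setOf_eq] at *
    rw [Matrix.transpose_add, hX, hY, neg_add]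
  zero_mem' := by simp
  smul_mem' := by
    intro r X hX
    simp only [Set.mem_setOf_eq] at *
    rw [Matrix.transpose_smul, hX, smul_neg]

/-- Block-diagonal matrices for the partition encoded by `c`. -/
def blockDiagSub (c : Fin N → Fin k₀) : Submodule ℝ (Matrix (Fin N) (Fin N) ℝ) where
  carrier := {X | ∀ i j : Fin N, c i ≠ c j → X i j = 0}
  add_mem' := by
    intro X Y hX hY i j h
    simp [Matrix.add_apply, hX i j h, hY i j h]
  zero_mem' := by intro i j h; rfl
  smul_mem' := by
    intro r X hX i j h
    simp [Matrix.smul_apply, hX i j h]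

/-- Strictly block upper-triangular matrices `𝔲`: matrices `X` with
`X·ℝ^{I_k} ⊆ ℝ^{I_1 ∪ ⋯ ∪ I_{k−1}}` for all `k`; equivalently `X i j = 0` whenever
`c j ≤ c i`. -/
def uSub (c : Fin N → Fin k₀) : Submodule ℝ (Matrix (Fin N) (Fin N) ℝ) where
  carrier := {X | ∀ i j : Fin N, c j ≤ c i → X i j = 0}
  add_mem' := by
    intro X Y hX hY i j h
    simp [Matrix.add_apply, hX i j h, hY i j h]
  zero_mem' := by intro i j h; rfl
  smul_mem' := by
    intro r X hX i j h
    simp [Matrix.smul_apply, hX i j h]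

/-- `d = Σ_{s<t} n_s n_t`, the number of pairs `(i,j)` whose blocks satisfy `c i < c j`;
this is the dimension of `𝔲`. -/
def offDim (c : Fin N → Fin k₀) : ℕ :=
  (Finset.univ.filter fun p : Fin N × Fin N => c p.1 < c p.2).card

section BlockDecomposition

variable {c : Fin N → Fin k₀}

/-- Parseval's identity for the trace form. -/
theorem sum_trace_mul_trace_of_mem_span {m ι : Type*} [Fintype m] [Fintype ι] [DecidableEq ι]
    {v : ι → Matrix m m ℝ}
    (hv : ∀ i j, (v i * (v j)ᵀ).trace = if i = j then (1 : ℝ) else 0)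
    {X : Matrix m m ℝ} (hX : X ∈ Submodule.span ℝ (Set.range v)) (Y : Matrix m m ℝ) :
    ∑ i, (X * (v i)ᵀ).trace * (Y * (v i)ᵀ).trace = (X * Yᵀ).trace := by
  induction hX using Submodule.span_induction with
  | mem x hx =>
    obtain ⟨k, rfl⟩ := hx
    simp only [hv, ite_mul, one_mul, zero_mul, Finset.sum_ite_eq, Finset.mem_univ, if_true]
    rw [← Matrix.trace_transpose, Matrix.transpose_mul, Matrix.transpose_transpose]
  | zero => simp
  | add x y _ _ hx hy =>
    simp only [add_mul, Matrix.trace_add, Finset.sum_add_distrib, hx, hy]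
  | smul r x _ hx =>
    simp only [smul_mul_assoc, Matrix.trace_smul, smul_eq_mul, mul_assoc, ← Finset.mul_sum, hx]

theorem soSub_le_slSub : soSub N ≤ slSub N := by
  intro X hX
  have h : X.trace = -X.trace := by
    conv_lhs => rw [← Matrix.trace_transpose, show Xᵀ = -X from hX, Matrix.trace_neg]
  change X.trace = 0
  linarith

theorem uSub_le_slSub : uSub c ≤ slSub N := by
  intro X hX
  change X.trace = 0
  exact Finset.sum_eq_zero fun i _ => hX i i le_rfl

theorem slSub_le_soSub_sup_blockDiagSub_sup_uSub :
    slSub N ≤ (soSub N ⊔ (blockDiagSub c ⊓ slSub N)) ⊔ uSub c := by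
  intro X hX
  let A : Matrix (Fin N) (Fin N) ℝ := Matrix.of fun i j =>
    if c i < c j then -X j i else if c j < c i then X i j else 0
  let D : Matrix (Fin N) (Fin N) ℝ := Matrix.of fun i j => if c i = c j then X i j else 0
  let U : Matrix (Fin N) (Fin N) ℝ := Matrix.of fun i j =>
    if c i < c j then X i j + X j i else 0
  have hXeq : X = A + D + U := by
    ext i j
    simp only [A, D, U, Matrix.add_apply, Matrix.of_apply]
    rcases lt_trichotomy (c i) (c j) with h | h | h
    · simp [h, h.ne]
    · simp [h]
    · simp [h, h.not_gt, h.ne']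
  have hA : A ∈ soSub N := by
    change Aᵀ = -A
    ext i j
    simp only [A, Matrix.transpose_apply, Matrix.neg_apply, Matrix.of_apply]
    rcases lt_trichotomy (c i) (c j) with h | h | h
    · simp [h, h.not_gt]
    · simp [h]
    · simp [h, h.not_gt]
  have hD : D ∈ blockDiagSub c := fun i j h => if_neg h
  have hDt : D ∈ slSub N := by
    have hX0 : X.trace = 0 := hX
    change D.trace = 0
    rw [← hX0]
    simp [Matrix.trace, D]
  have hU : U ∈ uSub c := fun i j h => if_neg h.not_gt
  rw [hXeq]
  exact Submodule.add_mem_sup (Submodule.add_mem_sup hA ⟨hD, hDt⟩) hU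

theorem soSub_sup_blockDiagSub_inf_uSub :
    (soSub N ⊔ (blockDiagSub c ⊓ slSub N)) ⊓ uSub c = ⊥ := by
  rw [eq_bot_iff]
  rintro X ⟨hS, hU⟩
  obtain ⟨A, hA, D, ⟨hD, -⟩, rfl⟩ := Submodule.mem_sup.mp hS
  rw [Submodule.mem_bot]
  ext i j
  rcases le_or_gt (c j) (c i) with h | h
  · exact hU i j h
  · have h1 : A j i + D j i = 0 := hU j i h.le
    have h2 : A j i = -A i j := congrFun (congrFun hA i) j
    simp only [Matrix.add_apply, Matrix.zero_apply]
    rw [hD j i h.ne'] at h1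
    rw [hD i j h.ne]
    linarith

theorem trace_mul_transpose_eq_sum (X Y : Matrix (Fin N) (Fin N) ℝ) :
    (X * Yᵀ).trace = ∑ i, ∑ j, X i j * Y i j := by
  simp [Matrix.trace, Matrix.mul_apply]

theorem trace_mul_eq_zero_of_mem_uSub {X Y : Matrix (Fin N) (Fin N) ℝ} (hX : X ∈ uSub c)
    (hY : Y ∈ uSub c) : (X * Y).trace = 0 := by
  rw [← Matrix.transpose_transpose Y, trace_mul_transpose_eq_sum]
  refine Finset.sum_eq_zero fun i _ => Finset.sum_eq_zero fun j _ => ?_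
  rcases le_or_gt (c j) (c i) with h | h
  · rw [hX i j h, zero_mul]
  · rw [Matrix.transpose_apply, hY j i h.le, mul_zero]

/-- The antisymmetric part of a matrix. -/
noncomputable def skewPart (X : Matrix (Fin N) (Fin N) ℝ) : Matrix (Fin N) (Fin N) ℝ :=
  (1 / 2 : ℝ) • (X - Xᵀ)

theorem skewPart_mem_soSub (X : Matrix (Fin N) (Fin N) ℝ) : skewPart X ∈ soSub N := by
  change (skewPart X)ᵀ = -skewPart X
  simp [skewPart, ← smul_neg]

/-- The orthogonal projection of `U ∈ 𝔲` onto `so_N + 𝔩` is its antisymmetric part. -/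
theorem trace_skewPart_mul_transpose {U X : Matrix (Fin N) (Fin N) ℝ} (hU : U ∈ uSub c)
    (hX : X ∈ soSub N ⊔ (blockDiagSub c ⊓ slSub N)) :
    (skewPart U * Xᵀ).trace = (U * Xᵀ).trace := by
  obtain ⟨A, hA, D, ⟨hD, -⟩, rfl⟩ := Submodule.mem_sup.mp hX
  have hAt : Aᵀ = -A := hA
  have h1 : (Uᵀ * Aᵀ).trace = -(U * Aᵀ).trace := by
    rw [← Matrix.transpose_mul, Matrix.trace_transpose, Matrix.trace_mul_comm, hAt]
    simp
  have h2 : (U * Dᵀ).trace = 0 := by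
    rw [trace_mul_transpose_eq_sum]
    refine Finset.sum_eq_zero fun i _ => Finset.sum_eq_zero fun j _ => ?_
    rcases eq_or_ne (c i) (c j) with h | h
    · rw [hU i j h.ge, zero_mul]
    · rw [hD i j h, mul_zero]
  have h3 : (Uᵀ * Dᵀ).trace = 0 := by
    rw [trace_mul_transpose_eq_sum]
    refine Finset.sum_eq_zero fun i _ => Finset.sum_eq_zero fun j _ => ?_
    rcases eq_or_ne (c i) (c j) with h | h
    · rw [Matrix.transpose_apply, hU j i h.le, zero_mul]
    · rw [hD i j h, mul_zero]
  simp only [skewPart, smul_mul_assoc, Matrix.trace_smul, sub_mul, Matrix.trace_sub,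
    Matrix.transpose_add, mul_add, Matrix.trace_add, h1, h2, h3, smul_eq_mul]
  ring

theorem trace_mul_transpose_skewPart {U V : Matrix (Fin N) (Fin N) ℝ} (hU : U ∈ uSub c)
    (hV : V ∈ uSub c) : (U * (skewPart V)ᵀ).trace = 1 / 2 * (U * Vᵀ).trace := by
  simp [skewPart, Matrix.mul_sub, trace_mul_eq_zero_of_mem_uSub hU hV]

theorem det_trace_mul_transpose_sq {m n p : Type*} [Fintype m] [Fintype n] [Fintype p]
    [DecidableEq n] [DecidableEq p] {vS : n → Matrix m m ℝ} {vU : p → Matrix m m ℝ}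
    {e : n ⊕ p → Matrix m m ℝ}
    (hS : ∀ i j, (vS i * (vS j)ᵀ).trace = if i = j then (1 : ℝ) else 0)
    (hU : ∀ i j, (vU i * (vU j)ᵀ).trace = if i = j then (1 : ℝ) else 0)
    (he : ∀ k l, (e k * (e l)ᵀ).trace = if k = l then (1 : ℝ) else 0)
    (hmem : ∀ l, Sum.elim vS vU l ∈ Submodule.span ℝ (Set.range e))
    {r : ℝ} (hr : ∀ j k, ∑ i, (vU j * (vS i)ᵀ).trace * (vU k * (vS i)ᵀ).trace =
      if j = k then r else 0) :
    (Matrix.of fun k l : n ⊕ p => ((Sum.elim vS vU l) * (e k)ᵀ).trace).det ^ 2 =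
      (1 - r) ^ Fintype.card p := by
  set M : Matrix (n ⊕ p) (n ⊕ p) ℝ :=
    Matrix.of fun k l => ((Sum.elim vS vU l) * (e k)ᵀ).trace with hM
  let B : Matrix p n ℝ := Matrix.of fun j i => (vU j * (vS i)ᵀ).trace
  have hG : Mᵀ * M = Matrix.fromBlocks 1 Bᵀ B 1 := by
    ext a b
    have hab : (Mᵀ * M) a b = (Sum.elim vS vU a * (Sum.elim vS vU b)ᵀ).trace := by
      rw [← sum_trace_mul_trace_of_mem_span he (hmem a)]
      rfl
    rw [hab]
    rcases a with a | a <;> rcases b with b | b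
    · simpa [Matrix.one_apply] using hS a b
    · simp only [Sum.elim_inl, Sum.elim_inr, Matrix.fromBlocks_apply₁₂, B,
        Matrix.transpose_apply, Matrix.of_apply]
      rw [← Matrix.trace_transpose, Matrix.transpose_mul, Matrix.transpose_transpose]
    · rfl
    · simpa [Matrix.one_apply] using hU a b
  have hB : 1 - B * Bᵀ = (1 - r) • (1 : Matrix p p ℝ) := by
    ext j k
    have hjk : (B * Bᵀ) j k = if j = k then r else 0 := hr j k
    rw [Matrix.sub_apply, hjk, Matrix.smul_apply, Matrix.one_apply]
    split_ifs <;> simp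
  have hdet := congrArg Matrix.det hG
  rw [Matrix.det_mul, Matrix.det_transpose, Matrix.det_fromBlocks_one₁₁, hB, Matrix.det_smul,
    Matrix.det_one, mul_one] at hdet
  rw [pow_two, hdet]

end BlockDecomposition

/-- with `S = so_N + 𝔩` (`𝔩` the traceless block-diagonal matrices) and `𝔲`
the strictly block upper-triangular matrices: (i) `sl_N(ℝ) = S ⊕ 𝔲`; (ii) for orthonormal
(w.r.t. the Frobenius inner product `⟨X,Y⟩ = Tr(X Yᵀ)`) spanning families `vS` of `S`,
`vU` of `𝔲`, and any orthonormal basis `e` of `sl_N(ℝ)`, the determinant of the family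
`vS ∪ vU` in the basis `e` (whose matrix of coordinates is `⟨(vS ∪ vU) l, e k⟩`) has
absolute value `2^{−d/2}` where `d = dim 𝔲 = Σ_{s<t} n_s n_t`. -/
theorem stmt9 (hN : 2 ≤ N) (c : Fin N → Fin k₀) (hmono : Monotone c)
    (hsurj : Function.Surjective c) :
    ((soSub N ⊔ (blockDiagSub c ⊓ slSub N)) ⊔ uSub c = slSub N ∧
      (soSub N ⊔ (blockDiagSub c ⊓ slSub N)) ⊓ uSub c = ⊥) ∧
    ∀ (dS : ℕ) (vS : Fin dS → Matrix (Fin N) (Fin N) ℝ)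
      (vU : Fin (offDim c) → Matrix (Fin N) (Fin N) ℝ)
      (e : (Fin dS ⊕ Fin (offDim c)) → Matrix (Fin N) (Fin N) ℝ),
      (∀ i, vS i ∈ soSub N ⊔ (blockDiagSub c ⊓ slSub N)) →
      Submodule.span ℝ (Set.range vS) = soSub N ⊔ (blockDiagSub c ⊓ slSub N) →
      (∀ i j, (vS i * (vS j)ᵀ).trace = if i = j then (1 : ℝ) else 0) →
      (∀ i, vU i ∈ uSub c) →
      Submodule.span ℝ (Set.range vU) = uSub c →
      (∀ i j, (vU i * (vU j)ᵀ).trace = if i = j then (1 : ℝ) else 0) →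
      (∀ k, e k ∈ slSub N) →
      Submodule.span ℝ (Set.range e) = slSub N →
      (∀ k l, (e k * (e l)ᵀ).trace = if k = l then (1 : ℝ) else 0) →
      |(Matrix.of fun (k l : Fin dS ⊕ Fin (offDim c)) =>
          ((Sum.elim vS vU l) * (e k)ᵀ).trace).det| =
        (2 : ℝ) ^ (-(offDim c : ℝ) / 2) := by
  have hsup : (soSub N ⊔ (blockDiagSub c ⊓ slSub N)) ⊔ uSub c = slSub N :=
    le_antisymm (sup_le (sup_le soSub_le_slSub inf_le_right) uSub_le_slSub)
      slSub_le_soSub_sup_blockDiagSub_sup_uSub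
  refine ⟨⟨hsup, soSub_sup_blockDiagSub_inf_uSub⟩, ?_⟩
  intro dS vS vU e hvS hspanS hS hvU _ hU _ hspane he
  have hmem : ∀ l, Sum.elim vS vU l ∈ Submodule.span ℝ (Set.range e) := by
    rw [hspane, ← hsup]
    rintro (i | j)
    · exact Submodule.mem_sup_left (hvS i)
    · exact Submodule.mem_sup_right (hvU j)
  have hproj : ∀ j k, ∑ i, (vU j * (vS i)ᵀ).trace * (vU k * (vS i)ᵀ).trace =
      if j = k then (1 / 2 : ℝ) else 0 := by
    intro j k
    have hk : skewPart (vU k) ∈ soSub N ⊔ (blockDiagSub c ⊓ slSub N) :=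
      Submodule.mem_sup_left (skewPart_mem_soSub _)
    calc ∑ i, (vU j * (vS i)ᵀ).trace * (vU k * (vS i)ᵀ).trace
        = ∑ i, (skewPart (vU j) * (vS i)ᵀ).trace * (skewPart (vU k) * (vS i)ᵀ).trace := by
          simp only [trace_skewPart_mul_transpose (hvU _) (hvS _)]
      _ = (skewPart (vU j) * (skewPart (vU k))ᵀ).trace := by
          refine sum_trace_mul_trace_of_mem_span hS ?_ _
          rw [hspanS]
          exact Submodule.mem_sup_left (skewPart_mem_soSub _)
      _ = (vU j * (skewPart (vU k))ᵀ).trace := trace_skewPart_mul_transpose (hvU j) hk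
      _ = if j = k then (1 / 2 : ℝ) else 0 := by
          rw [trace_mul_transpose_skewPart (hvU j) (hvU k), hU]
          split_ifs <;> simp
  have hsq := det_trace_mul_transpose_sq hS hU he hmem hproj
  rw [← sq_eq_sq₀ (abs_nonneg _) (by positivity), sq_abs, hsq, ← Real.rpow_natCast (_ ^ _) 2,
    ← Real.rpow_mul (by norm_num), Fintype.card_fin]
  push_cast
  rw [div_mul_cancel₀ _ (by norm_num), Real.rpow_neg (by norm_num), Real.rpow_natCast,
    ← inv_pow]
  norm_num
end
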